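/- arXiv:math/0701767 — 2 statements merged into one kernel-verified Lean document; each statement's English description precedes it below -/
import Mathlib

section
/- Let T be a monad on a cocomplete category C. If the Eilenberg–Moore category C^T of T-algebras has coequalizers of reflexive pairs, then C^T is cocomplete. -/
open CategoryTheory CategoryTheory.Limits

universe w₁ w₂ v₁ v₂ u₁ u₂

/-- If every component of the counit of an adjunction is a regular epimorphism, then so is every
component of the counit of the adjunction induced by postcomposition on functor categories. -/
noncomputable def CategoryTheory.Adjunction.whiskerRightCounitRegularEpi
    {J : Type w₁} [Category.{w₂} J] {C : Type u₁} [Category.{v₁} C] {D : Type u₂}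
    [Category.{v₂} D] {F : C ⥤ D} {G : D ⥤ C} (adj : F ⊣ G)
    (h : ∀ X : D, RegularEpi (adj.counit.app X)) (X : J ⥤ D) :
    RegularEpi ((adj.whiskerRight J).counit.app X) where
  W := _
  left := _
  right := _
  w := (adj.whiskerRight J).counit_naturality ((adj.whiskerRight J).counit.app X)
  isColimit := evaluationJointlyReflectsColimits _ fun j => by
    refine (isColimitMapCoconeCoforkEquiv _ _).symm ?_
    exact Cofork.isColimitOfIsos _ (LiftLeftAdjoint.counitCoequalises adj h (X.obj j)) _
      (Iso.refl _) (Iso.refl _) (Iso.refl _) (by simp) (by simp) (by simp)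

/-- The category of algebras over a monad on a category with colimits of shape `J` has colimits of
shape `J` as soon as it has reflexive coequalizers. -/
theorem CategoryTheory.Monad.hasColimitsOfShape_algebra_of_hasReflexiveCoequalizers
    {J : Type w₁} [Category.{w₂} J] {C : Type u₁} [Category.{v₁} C] [HasColimitsOfShape J C]
    (T : Monad C) [HasReflexiveCoequalizers T.Algebra] : HasColimitsOfShape J T.Algebra := by
  rw [hasColimitsOfShape_iff_isRightAdjoint_const]
  have : (Functor.const J ⋙ (Functor.whiskeringRight J _ _).obj T.forget).IsRightAdjoint :=
    ((colimConstAdj.comp T.adj).ofNatIsoRight (Iso.refl _)).isRightAdjoint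
  exact isRightAdjoint_triangle_lift _ (T.adj.whiskerRight J)
    (T.adj.whiskerRightCounitRegularEpi fun X => by
      rw [T.adj_counit]
      exact ⟨_, _, _, _, Monad.beckAlgebraCoequalizer X⟩)

/-- If `T` is a monad on a cocomplete category `C` and the
Eilenberg–Moore category of `T`-algebras has reflexive coequalizers, then the category
of `T`-algebras is cocomplete. -/
theorem monad_algebra_cocomplete
    {C : Type*} [Category C] [HasColimits C] (T : Monad C)
    [HasReflexiveCoequalizers T.Algebra] :
    HasColimits T.Algebra := by
  exact ⟨fun _ _ => T.hasColimitsOfShape_algebra_of_hasReflexiveCoequalizers⟩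
end

section
/- Let S be a small monoidal category and let C be a monoidal category having coequalizers of reflexive pairs such that, for every object A of C, the functors A ⊗ - and - ⊗ A preserve coequalizers of reflexive pairs. Then the category of lax monoidal functors from S to C, with monoidal natural transformations as morphisms, has coequalizers of reflexive pairs, and these are created by the forgetful functor to the functor category [S, C] (so they are computed pointwise in C). -/
open CategoryTheory CategoryTheory.Limits MonoidalCategory

universe v₁ v₂ u₁ u₂

variable (S : Type u₁) [Category.{v₁} S] [MonoidalCategory S]
variable (C : Type u₂) [Category.{v₂} C] [MonoidalCategory C]

/-- The forgetful functor from the category of lax monoidal functors `S ⥤ C` (with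
monoidal natural transformations as morphisms) to the ordinary functor category. -/
def laxMonoidalForget : LaxMonoidalFunctor S C ⥤ (S ⥤ C) where
  obj F := F.toFunctor
  map α := α.hom

instance laxMonoidalForget_reflectsIsomorphisms :
    (laxMonoidalForget S C).ReflectsIsomorphisms where
  reflects {F G} f h := by
    have : IsIso f.hom := h
    have : NatTrans.IsMonoidal (asIso f.hom).hom := f.isMonoidal
    exact (LaxMonoidalFunctor.isoMk (asIso f.hom)).isIso_hom

section

open Functor.LaxMonoidal

variable {S C}

/-- A morphism out of `B ⊗ B'` that coequalizes both pairs separately descends to the tensor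
product of the coequalizers. -/
lemma exists_tensorHom_desc {A B Q A' B' Q' Z : C} {a b : A ⟶ B} {q : B ⟶ Q}
    {w : a ≫ q = b ≫ q} (hq : IsColimit (Cofork.ofπ q w))
    {a' b' : A' ⟶ B'} {q' : B' ⟶ Q'} {w' : a' ≫ q' = b' ≫ q'}
    (hq' : IsColimit (Cofork.ofπ q' w'))
    [PreservesColimit (parallelPair a b) (tensorRight B')]
    [PreservesColimit (parallelPair a' b') (tensorLeft Q)] [Epi (q ▷ A')]
    (h : B ⊗ B' ⟶ Z) (h₁ : a ▷ B' ≫ h = b ▷ B' ≫ h) (h₂ : B ◁ a' ≫ h = B ◁ b' ≫ h) :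
    ∃ d : Q ⊗ Q' ⟶ Z, (q ⊗ₘ q') ≫ d = h := by
  obtain ⟨k, hk⟩ := Cofork.IsColimit.desc'
    (isColimitCoforkMapOfIsColimit (tensorRight B') w hq) h h₁
  replace hk : q ▷ B' ≫ k = h := hk
  have hk' : Q ◁ a' ≫ k = Q ◁ b' ≫ k := by
    rw [← cancel_epi (q ▷ A'), ← whisker_exchange_assoc, ← whisker_exchange_assoc, hk, h₂]
  obtain ⟨d, hd⟩ := Cofork.IsColimit.desc'
    (isColimitCoforkMapOfIsColimit (tensorLeft Q) w' hq') k hk'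
  replace hd : Q ◁ q' ≫ d = k := hd
  exact ⟨d, by rw [MonoidalCategory.tensorHom_def, Category.assoc, hd, hk]⟩

/-- A pointwise quotient of a lax monoidal functor to which the tensorator descends is lax
monoidal, provided the quotient maps stay epimorphic after tensoring. -/
@[reducible]
def laxMonoidalOfQuotient {G Q : S ⥤ C} [G.LaxMonoidal] (π : G ⟶ Q)
    [∀ X Z, Epi (π.app X ▷ Z)] [∀ X Z, Epi (Z ◁ π.app X)]
    [∀ X Z W, Epi (Z ◁ π.app X ▷ W)]
    (m : ∀ X Y, Q.obj X ⊗ Q.obj Y ⟶ Q.obj (X ⊗ Y))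
    (hm : ∀ X Y, (π.app X ⊗ₘ π.app Y) ≫ m X Y = μ G X Y ≫ π.app (X ⊗ Y)) :
    Q.LaxMonoidal where
  ε := ε G ≫ π.app _
  μ := m
  μ_natural_left {X Y} f X' := by
    have : Epi (π.app X ⊗ₘ π.app X') := by rw [MonoidalCategory.tensorHom_def]; infer_instance
    rw [← cancel_epi (π.app X ⊗ₘ π.app X'), reassoc_of% hm, ← π.naturality,
      ← μ_natural_left_assoc, ← hm, ← tensorHom_id, ← tensorHom_id,
      tensorHom_comp_tensorHom_assoc, tensorHom_comp_tensorHom_assoc, π.naturality]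
    simp
  μ_natural_right {X Y} X' f := by
    have : Epi (π.app X' ⊗ₘ π.app X) := by rw [MonoidalCategory.tensorHom_def]; infer_instance
    rw [← cancel_epi (π.app X' ⊗ₘ π.app X), reassoc_of% hm, ← π.naturality,
      ← μ_natural_right_assoc, ← hm, ← id_tensorHom, ← id_tensorHom,
      tensorHom_comp_tensorHom_assoc, tensorHom_comp_tensorHom_assoc, π.naturality]
    simp
  associativity X Y Z := by
    have : Epi ((π.app X ▷ G.obj Y) ▷ G.obj Z) := by
      have h : (π.app X ▷ G.obj Y) ▷ G.obj Z =
          (α_ _ _ _).hom ≫ π.app X ▷ (G.obj Y ⊗ G.obj Z) ≫ (α_ _ _ _).inv := by simp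
      rw [h]; infer_instance
    have : Epi ((Q.obj X ◁ π.app Y) ▷ G.obj Z) := by
      rw [whisker_assoc]; infer_instance
    have : Epi ((π.app X ⊗ₘ π.app Y) ▷ G.obj Z) := by
      rw [MonoidalCategory.tensorHom_def, comp_whiskerRight]; infer_instance
    have : Epi ((π.app X ⊗ₘ π.app Y) ⊗ₘ π.app Z) := by
      rw [MonoidalCategory.tensorHom_def]; infer_instance
    rw [← cancel_epi ((π.app X ⊗ₘ π.app Y) ⊗ₘ π.app Z), associator_naturality_assoc,
      ← tensorHom_id, ← id_tensorHom, tensorHom_comp_tensorHom_assoc,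
      tensorHom_comp_tensorHom_assoc, hm, hm, Category.comp_id, Category.comp_id,
      ← whiskerRight_comp_tensorHom_assoc, ← whiskerLeft_comp_tensorHom_assoc,
      reassoc_of% hm, hm, ← π.naturality, associativity_assoc]
  left_unitality X := by
    rw [← cancel_epi (𝟙_ C ◁ π.app X), leftUnitor_naturality, left_unitality G X,
      comp_whiskerRight, Category.assoc, Category.assoc, Category.assoc,
      whisker_exchange_assoc, whisker_exchange_assoc, ← MonoidalCategory.tensorHom_def_assoc,
      reassoc_of% hm, π.naturality]
  right_unitality X := by
    rw [← cancel_epi (π.app X ▷ 𝟙_ C), rightUnitor_naturality, right_unitality G X,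
      MonoidalCategory.whiskerLeft_comp, Category.assoc, Category.assoc, Category.assoc,
      ← whisker_exchange_assoc, ← whisker_exchange_assoc, ← MonoidalCategory.tensorHom_def'_assoc,
      reassoc_of% hm, π.naturality]

/-- The tensorator of `G` descends to the pointwise coequalizer of a reflexive pair of monoidal
natural transformations into `G`. -/
lemma exists_tensorator_desc {F G Q : S ⥤ C} [F.LaxMonoidal] [G.LaxMonoidal] {f g : F ⟶ G}
    [NatTrans.IsMonoidal f] [NatTrans.IsMonoidal g] {s : G ⟶ F}
    (hsf : s ≫ f = 𝟙 G) (hsg : s ≫ g = 𝟙 G) {π : G ⟶ Q} (w : f ≫ π = g ≫ π)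
    {X Y : S}
    (hX : IsColimit (Cofork.ofπ (π.app X) (NatTrans.congr_app w X)))
    (hY : IsColimit (Cofork.ofπ (π.app Y) (NatTrans.congr_app w Y)))
    [PreservesColimit (parallelPair (f.app X) (g.app X)) (tensorRight (G.obj Y))]
    [PreservesColimit (parallelPair (f.app Y) (g.app Y)) (tensorLeft (Q.obj X))]
    [Epi (π.app X ▷ F.obj Y)] :
    ∃ d : Q.obj X ⊗ Q.obj Y ⟶ Q.obj (X ⊗ Y),
      (π.app X ⊗ₘ π.app Y) ≫ d = μ G X Y ≫ π.app (X ⊗ Y) := by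
  have key {k : F ⟶ G} [NatTrans.IsMonoidal k] (hk : s ≫ k = 𝟙 G) :
      k.app X ▷ G.obj Y ≫ μ G X Y = F.obj X ◁ s.app Y ≫ μ F X Y ≫ k.app (X ⊗ Y) ∧
      G.obj X ◁ k.app Y ≫ μ G X Y = s.app X ▷ F.obj Y ≫ μ F X Y ≫ k.app (X ⊗ Y) := by
    have hk' (X : S) : s.app X ≫ k.app X = 𝟙 _ := NatTrans.congr_app hk X
    constructor
    · rw [NatTrans.IsMonoidal.tensor, ← id_tensorHom, tensorHom_comp_tensorHom_assoc, hk',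
        Category.id_comp, tensorHom_id]
    · rw [NatTrans.IsMonoidal.tensor, ← tensorHom_id, tensorHom_comp_tensorHom_assoc, hk',
        Category.id_comp, id_tensorHom]
  have hw : f.app (X ⊗ Y) ≫ π.app (X ⊗ Y) = g.app (X ⊗ Y) ≫ π.app (X ⊗ Y) :=
    NatTrans.congr_app w _
  refine exists_tensorHom_desc hX hY _ ?_ ?_
  · rw [reassoc_of% (key hsf).1, reassoc_of% (key hsg).1, hw]
  · rw [reassoc_of% (key hsf).2, reassoc_of% (key hsg).2, hw]

lemma hasColimit_parallelPair_flip_obj {J : Type u₁} [Category.{v₁} J] {D : Type u₂} [Category.{v₂} D]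
    {F G : J ⥤ D} (f g : F ⟶ G) (X : J)
    [HasCoequalizer (f.app X) (g.app X)] : HasColimit ((parallelPair f g).flip.obj X) :=
  have : HasColimit (parallelPair (((parallelPair f g).flip.obj X).map .left)
      (((parallelPair f g).flip.obj X).map .right)) :=
    inferInstanceAs (HasCoequalizer (f.app X) (g.app X))
  hasColimit_of_iso (diagramIsoParallelPair ((parallelPair f g).flip.obj X))

lemma hasCoequalizer_of_app {J : Type u₁} [Category.{v₁} J] {D : Type u₂} [Category.{v₂} D]
    {F G : J ⥤ D} (f g : F ⟶ G)
    [∀ X, HasCoequalizer (f.app X) (g.app X)] : HasCoequalizer f g :=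
  have := hasColimit_parallelPair_flip_obj f g
  inferInstance

/-- A cofork of functors that is a colimit is a pointwise colimit, provided the pointwise
coequalizers exist. -/
noncomputable def isColimitCoforkApp {J : Type u₁} [Category.{v₁} J] {D : Type u₂} [Category.{v₂} D]
    {F G Q : J ⥤ D} {f g : F ⟶ G} {π : G ⟶ Q}
    {w : f ≫ π = g ≫ π} (h : IsColimit (Cofork.ofπ π w))
    [∀ X, HasCoequalizer (f.app X) (g.app X)] (X : J) :
    IsColimit (Cofork.ofπ (π.app X) (NatTrans.congr_app w X)) := by
  have := hasColimit_parallelPair_flip_obj f g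
  exact isColimitCoforkMapOfIsColimit ((evaluation J D).obj X) w h

/-- A quotient of lax monoidal functors has the universal property of a coequalizer as soon as
its underlying natural transformation has, provided it is epimorphic after tensoring. -/
noncomputable def isColimitCoforkOfForget {F G Q : LaxMonoidalFunctor S C} {f g : F ⟶ G}
    {π : G ⟶ Q} {w : f ≫ π = g ≫ π}
    (h : IsColimit (Cofork.ofπ (f := f.hom) (g := g.hom) π.hom
      (congrArg LaxMonoidalFunctor.Hom.hom w)))
    [∀ X Y, Epi (π.hom.app X ⊗ₘ π.hom.app Y)] :
    IsColimit (Cofork.ofπ π w) :=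
  Cofork.IsColimit.mk' _ fun t => by
    let d : Q.toFunctor ⟶ t.pt.toFunctor := h.desc (Cofork.ofπ t.π.hom
      (congrArg LaxMonoidalFunctor.Hom.hom t.condition))
    have hd : π.hom ≫ d = t.π.hom := h.fac _ .one
    have hd' (X : S) : π.hom.app X ≫ d.app X = t.π.hom.app X := NatTrans.congr_app hd X
    have : NatTrans.IsMonoidal d :=
      { unit := by
          rw [← NatTrans.IsMonoidal.unit (τ := π.hom), Category.assoc, hd',
            NatTrans.IsMonoidal.unit]
        tensor X Y := by
          rw [← cancel_epi (π.hom.app X ⊗ₘ π.hom.app Y), ← NatTrans.IsMonoidal.tensor_assoc,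
            hd', tensorHom_comp_tensorHom_assoc, hd', hd', NatTrans.IsMonoidal.tensor] }
    refine ⟨LaxMonoidalFunctor.homMk d, LaxMonoidalFunctor.hom_ext hd, fun {m} hm => ?_⟩
    exact LaxMonoidalFunctor.hom_ext (Cofork.IsColimit.hom_ext h
      ((congrArg LaxMonoidalFunctor.Hom.hom hm).trans hd.symm))

end

/-- If `S` is a small monoidal category and `C` is a monoidal category
with reflexive coequalizers in which `A ⊗ -` and `- ⊗ A` preserve reflexive
coequalizers, then the category of lax monoidal functors `S ⥤ C` has reflexive
coequalizers, and these are created by the forgetful functor to `[S, C]` (hence are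
computed pointwise in `C`). -/
theorem laxMonoidalFunctorCategory_hasReflexiveCoequalizers
    {S : Type u₁} [SmallCategory S] [MonoidalCategory S]
    {C : Type u₂} [Category.{v₂} C] [MonoidalCategory C]
    [HasReflexiveCoequalizers C]
    (hleft : ∀ (A : C) ⦃X Y : C⦄ (f g : X ⟶ Y), IsReflexivePair f g →
      PreservesColimit (parallelPair f g) (tensorLeft A))
    (hright : ∀ (A : C) ⦃X Y : C⦄ (f g : X ⟶ Y), IsReflexivePair f g →
      PreservesColimit (parallelPair f g) (tensorRight A)) :
    ∀ ⦃F G : LaxMonoidalFunctor S C⦄ (f g : F ⟶ G), IsReflexivePair f g →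
      HasColimit (parallelPair f g) ∧
        Nonempty (CreatesColimit (parallelPair f g) (laxMonoidalForget S C)) := by
  intro F G f g _
  let s := commonSection f g
  have hsf : s.hom ≫ f.hom = 𝟙 G.toFunctor :=
    congrArg LaxMonoidalFunctor.Hom.hom (section_comp_left f g)
  have hsg : s.hom ≫ g.hom = 𝟙 G.toFunctor :=
    congrArg LaxMonoidalFunctor.Hom.hom (section_comp_right f g)
  have hrefl (X : S) : IsReflexivePair (f.hom.app X) (g.hom.app X) :=
    .mk' (s.hom.app X) (NatTrans.congr_app hsf X) (NatTrans.congr_app hsg X)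
  have (X : S) : HasCoequalizer (f.hom.app X) (g.hom.app X) :=
    HasReflexiveCoequalizers.has_coeq _ _
  have (X : S) (A : C) := hleft A _ _ (hrefl X)
  have (X : S) (A : C) := hright A _ _ (hrefl X)
  have creates : Nonempty (CreatesColimit (parallelPair f g) (laxMonoidalForget S C)) := by
    refine ⟨createsColimitOfReflectsIso fun c hc => ?_⟩
    let π : G.toFunctor ⟶ c.pt := c.ι.app .one
    have w : f.hom ≫ π = g.hom ≫ π :=
      (c.w WalkingParallelPairHom.left).trans (c.w WalkingParallelPairHom.right).symm
    have hπ : IsColimit (Cofork.ofπ π w) := by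
      let e : parallelPair f g ⋙ laxMonoidalForget S C ≅ parallelPair f.hom g.hom :=
        diagramIsoParallelPair _
      have i : (Cocone.precompose e.inv).obj c ≅ Cofork.ofπ π w :=
        Cofork.ext (Iso.refl _) ((Category.comp_id _).trans (Category.id_comp _))
      exact IsColimit.equivOfNatIsoOfIso e c _ i hc
    have hπX (X : S) := isColimitCoforkApp hπ X
    have (X : S) (Z : C) : Epi (π.app X ▷ Z) :=
      epi_of_isColimit_cofork (isColimitCoforkMapOfIsColimit (tensorRight Z) _ (hπX X))
    have (X : S) (Z : C) : Epi (Z ◁ π.app X) :=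
      epi_of_isColimit_cofork (isColimitCoforkMapOfIsColimit (tensorLeft Z) _ (hπX X))
    have (X : S) (Z W : C) : Epi (Z ◁ π.app X ▷ W) := by
      have : IsReflexivePair (f.hom.app X ▷ W) (g.hom.app X ▷ W) :=
        .mk' (s.hom.app X ▷ W)
          (by simpa using congrArg (· ▷ W) (NatTrans.congr_app hsf X))
          (by simpa using congrArg (· ▷ W) (NatTrans.congr_app hsg X))
      have : PreservesColimit (parallelPair ((tensorRight W).map (f.hom.app X))
          ((tensorRight W).map (g.hom.app X))) (tensorLeft Z) := hleft Z _ _ this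
      exact epi_of_isColimit_cofork (isColimitCoforkMapOfIsColimit (tensorLeft Z) _
        (isColimitCoforkMapOfIsColimit (tensorRight W) _ (hπX X)))
    choose m hm using fun X Y => exists_tensorator_desc hsf hsg w (hπX X) (hπX Y)
    letI : c.pt.LaxMonoidal := laxMonoidalOfQuotient π m hm
    have : NatTrans.IsMonoidal π := ⟨rfl, fun X Y => (hm X Y).symm⟩
    let p : G ⟶ LaxMonoidalFunctor.of c.pt := ⟨π, this⟩
    have (X Y : S) : Epi (p.hom.app X ⊗ₘ p.hom.app Y) := by
      rw [MonoidalCategory.tensorHom_def]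
      exact epi_comp (π.app X ▷ _) (_ ◁ π.app Y)
    exact
      { liftedCocone := Cofork.ofπ p (LaxMonoidalFunctor.hom_ext (by exact w))
        validLift := Cocone.ext (Iso.refl _) (by
          rintro (_ | _)
          · exact (Category.comp_id _).trans (c.w WalkingParallelPairHom.left)
          · exact Category.comp_id _)
        makesColimit := isColimitCoforkOfForget hπ }
  obtain ⟨hc⟩ := creates
  have : HasColimit (parallelPair f g ⋙ laxMonoidalForget S C) := by
    have : HasCoequalizer f.hom g.hom := hasCoequalizer_of_app f.hom g.hom
    let e : parallelPair f g ⋙ laxMonoidalForget S C ≅ parallelPair f.hom g.hom :=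
      diagramIsoParallelPair _
    exact hasColimit_of_iso e
  exact ⟨hasColimit_of_created _ (laxMonoidalForget S C), ⟨hc⟩⟩
end
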